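/- There exists a universal constant C such that for every finite set E ⊂ ℝ² and every x ∈ ℝ²: C⁻¹·σ♯(x,16) ⊆ σ(x,E) ⊆ C·σ♯(x,16), where for a convex set σ of affine polynomials and λ > 0, λ·σ := {λ·P : P ∈ σ}. -/

import Mathlib

open scoped Pointwise

/-- The plane `ℝ²`. -/
abbrev E2 := EuclideanSpace ℝ (Fin 2)

/-- An affine polynomial on `ℝ²`, represented by its constant term and linear
part: `P(y) = P.1 + P.2 y`. -/
abbrev AffPoly := ℝ × (E2 →L[ℝ] ℝ)

/-- The one-jet `J_x φ` of `φ` at `x`, as an affine polynomial. -/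
noncomputable def jet1 (φ : E2 → ℝ) (x : E2) : AffPoly :=
  (φ x - fderiv ℝ φ x x, fderiv ℝ φ x)

/-- `σ(x,S)`: the set of one-jets at `x` of `C²` functions vanishing on `S`
with `C²` norm at most `1`. -/
def sigmaSet (x : E2) (S : Set E2) : Set AffPoly :=
  {p | ∃ φ : E2 → ℝ, ContDiff ℝ 2 φ ∧ (∀ y ∈ S, φ y = 0) ∧
    (∀ z : E2, ∀ i : ℕ, i ≤ 2 → ‖iteratedFDeriv ℝ i φ z‖ ≤ 1) ∧ p = jet1 φ x}

/-- `σ♯(x,k) = ⋂_{S ⊆ E, #S ≤ k} σ(x,S)`. -/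
def sigmaSharp (E : Set E2) (x : E2) (k : ℕ) : Set AffPoly :=
  ⋂ (S : Set E2) (_ : S ⊆ E ∧ S.ncard ≤ k), sigmaSet x S

/-- `g` is twice continuously differentiable on `ℝ` with first and second derivatives `g₁`, `g₂`. -/
structure IsC2Chain (g g₁ g₂ : ℝ → ℝ) : Prop where
  hasDerivAt : ∀ y, HasDerivAt g (g₁ y) y
  hasDerivAt' : ∀ y, HasDerivAt g₁ (g₂ y) y
  continuous : Continuous g₂

namespace IsC2Chain

variable {g g₁ g₂ f f₁ f₂ : ℝ → ℝ} {K : ℝ}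

theorem add (hg : IsC2Chain g g₁ g₂) (hf : IsC2Chain f f₁ f₂) :
    IsC2Chain (fun y => g y + f y) (fun y => g₁ y + f₁ y) (fun y => g₂ y + f₂ y) :=
  ⟨fun y => (hg.hasDerivAt y).add (hf.hasDerivAt y),
    fun y => (hg.hasDerivAt' y).add (hf.hasDerivAt' y), hg.continuous.add hf.continuous⟩

theorem deriv_eq (hg : IsC2Chain g g₁ g₂) : deriv g = g₁ :=
  funext fun y => (hg.hasDerivAt y).deriv

theorem deriv_eq' (hg : IsC2Chain g g₁ g₂) : deriv g₁ = g₂ :=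
  funext fun y => (hg.hasDerivAt' y).deriv

theorem contDiff (hg : IsC2Chain g g₁ g₂) : ContDiff ℝ 2 g := by
  have h1 : ContDiff ℝ 1 g₁ := by
    rw [contDiff_one_iff_deriv, hg.deriv_eq']
    exact ⟨fun y => (hg.hasDerivAt' y).differentiableAt, hg.continuous⟩
  have : ContDiff ℝ (1 + 1) g := by
    rw [contDiff_succ_iff_deriv, hg.deriv_eq]
    exact ⟨fun y => (hg.hasDerivAt y).differentiableAt, by simp, h1⟩
  simpa [one_add_one_eq_two] using this

theorem of_contDiff (hg : ContDiff ℝ 2 g) : IsC2Chain g (deriv g) (deriv (deriv g)) := by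
  have h : ContDiff ℝ (1 + 1) g := by simpa [one_add_one_eq_two] using hg
  rw [contDiff_succ_iff_deriv] at h
  obtain ⟨hd, -, h1⟩ := h
  rw [contDiff_one_iff_deriv] at h1
  exact ⟨fun y => (hd y).hasDerivAt, fun y => (h1.1 y).hasDerivAt, h1.2⟩

theorem abs_deriv_sub_le (hg : IsC2Chain g g₁ g₂) (hK : ∀ y, |g₂ y| ≤ K) (x y : ℝ) :
    |g₁ y - g₁ x| ≤ K * |y - x| := by
  have := Convex.norm_image_sub_le_of_norm_hasDerivWithin_le (f := g₁) (f' := g₂) (s := Set.univ)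
    (C := K) (x := x) (y := y) (fun z _ => (hg.hasDerivAt' z).hasDerivWithinAt)
    (fun z _ => hK z) convex_univ trivial trivial
  simpa using this

theorem abs_sub_taylor_le (hg : IsC2Chain g g₁ g₂) (hK : ∀ y, |g₂ y| ≤ K) (x y : ℝ) :
    |g y - g x - g₁ x * (y - x)| ≤ K * (y - x) ^ 2 := by
  have hK0 : 0 ≤ K := (abs_nonneg _).trans (hK 0)
  have := Convex.norm_image_sub_le_of_norm_hasDerivWithin_le (f := fun z => g z - g₁ x * z)
    (f' := fun z => g₁ z - g₁ x) (s := Set.uIcc x y)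
    (C := K * |y - x|) (x := x) (y := y)
    (fun z _ => by
      have := (hg.hasDerivAt z).sub ((hasDerivAt_id z).const_mul (g₁ x))
      simp only [mul_one] at this
      exact this.hasDerivWithinAt)
    (fun z hz => (hg.abs_deriv_sub_le hK x z).trans
      (mul_le_mul_of_nonneg_left (Set.abs_sub_left_of_mem_uIcc hz) hK0)) (convex_uIcc x y)
    Set.left_mem_uIcc Set.right_mem_uIcc
  rw [Real.norm_eq_abs, Real.norm_eq_abs] at this
  calc |g y - g x - g₁ x * (y - x)| = |g y - g₁ x * y - (g x - g₁ x * x)| := by ring_nf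
    _ ≤ K * |y - x| * |y - x| := this
    _ = K * (y - x) ^ 2 := by rw [mul_assoc, abs_mul_abs_self, sq]

end IsC2Chain

/-- A `C²` transition from `0` to `1`, flat up to second order outside `(0, 1)`. -/
theorem exists_transition : ∃ (κ κ₁ κ₂ : ℝ → ℝ) (B : ℝ), 1 ≤ B ∧ IsC2Chain κ κ₁ κ₂ ∧
    (∀ y, |κ y| ≤ B ∧ |κ₁ y| ≤ B ∧ |κ₂ y| ≤ B) ∧
    (∀ y ≤ 0, κ y = 0 ∧ κ₁ y = 0 ∧ κ₂ y = 0) ∧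
    (∀ y ≥ 1, κ y = 1 ∧ κ₁ y = 0 ∧ κ₂ y = 0) := by
  set κ : ℝ → ℝ := fun y => Real.smoothTransition (3 * y - 1) with hκ
  have hc : ContDiff ℝ 2 κ :=
    Real.smoothTransition.contDiff.comp ((contDiff_const.mul contDiff_id).sub contDiff_const)
  have hch := IsC2Chain.of_contDiff hc
  have hconst : ∀ (c y : ℝ), κ =ᶠ[nhds y] (fun _ => c) →
      κ y = c ∧ deriv κ y = 0 ∧ deriv (deriv κ) y = 0 := fun c y h => by
    refine ⟨h.eq_of_nhds, ?_, ?_⟩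
    · rw [h.deriv_eq]; simp
    · rw [h.deriv.deriv_eq]; simp
  have h0 : ∀ y ≤ 0, κ y = 0 ∧ deriv κ y = 0 ∧ deriv (deriv κ) y = 0 := fun y hy => by
    refine hconst 0 y ?_
    filter_upwards [Iio_mem_nhds (show y < 1 / 3 by linarith)] with z hz
    exact Real.smoothTransition.zero_of_nonpos (by linarith [Set.mem_Iio.1 hz])
  have h1 : ∀ y ≥ 1, κ y = 1 ∧ deriv κ y = 0 ∧ deriv (deriv κ) y = 0 := fun y hy => by
    refine hconst 1 y ?_
    filter_upwards [Ioi_mem_nhds (show (2 / 3 : ℝ) < y by linarith)] with z hz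
    exact Real.smoothTransition.one_of_one_le (by linarith [Set.mem_Ioi.1 hz])
  obtain ⟨B₁, hB₁⟩ := (isCompact_Icc (a := (0 : ℝ)) (b := 1)).exists_bound_of_continuousOn
    (f := deriv κ) (continuous_iff_continuousAt.2
      fun y => (hch.hasDerivAt' y).continuousAt).continuousOn
  obtain ⟨B₂, hB₂⟩ := (isCompact_Icc (a := (0 : ℝ)) (b := 1)).exists_bound_of_continuousOn
    (f := deriv (deriv κ)) hch.continuous.continuousOn
  refine ⟨κ, deriv κ, deriv (deriv κ), 1 + |B₁| + |B₂|, ?_, hch, fun y => ?_, h0, h1⟩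
  · linarith [abs_nonneg B₁, abs_nonneg B₂]
  · have hp := abs_nonneg B₁
    have hp' := abs_nonneg B₂
    refine ⟨?_, ?_, ?_⟩
    · rw [abs_of_nonneg (Real.smoothTransition.nonneg _)]
      linarith [Real.smoothTransition.le_one (3 * y - 1)]
    all_goals
      rcases le_total y 0 with hy | hy
      · simp only [h0 y hy, abs_zero]; positivity
      rcases le_total 1 y with hy' | hy'
      · simp only [h1 y hy', abs_zero]; positivity
    · have := hB₁ y ⟨hy, hy'⟩
      rw [Real.norm_eq_abs] at this
      linarith [le_abs_self B₁]
    · have := hB₂ y ⟨hy, hy'⟩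
      rw [Real.norm_eq_abs] at this
      linarith [le_abs_self B₂]

/-- Transition from `0` to an affine function that is small on `[b, a]`. -/
theorem exists_affine_transition : ∃ B : ℝ, 1 ≤ B ∧ ∀ (a b p q M : ℝ), b < a → 0 ≤ M →
    |p| ≤ M * (a - b) ^ 2 → |q| ≤ M * (a - b) →
    ∃ f f₁ f₂ : ℝ → ℝ, IsC2Chain f f₁ f₂ ∧ (∀ y, |f₂ y| ≤ B * M) ∧
      (∀ y ≤ b, f y = 0 ∧ f₁ y = 0 ∧ f₂ y = 0) ∧
      (∀ y ≥ a, f y = p + q * (y - b) ∧ f₁ y = q ∧ f₂ y = 0) := by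
  obtain ⟨κ, κ₁, κ₂, B, hB, hκ, hbd, h0, h1⟩ := exists_transition
  refine ⟨4 * B, by linarith, fun a b p q M hab hM hp hq => ?_⟩
  have hδ : 0 < a - b := sub_pos.2 hab
  set δ := a - b with hδdef
  have hleft : ∀ y ≤ b, (y - b) / δ ≤ 0 := fun y hy =>
    div_nonpos_of_nonpos_of_nonneg (by linarith) hδ.le
  have hright : ∀ y ≥ a, (y - b) / δ ≥ 1 := fun y hy => (one_le_div hδ).2 (by linarith)
  have hlin : ∀ y : ℝ, HasDerivAt (fun y => (y - b) / δ) (1 / δ) y := fun y =>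
    ((hasDerivAt_id y).sub_const b).div_const δ
  have haff : ∀ y : ℝ, HasDerivAt (fun y => p + q * (y - b)) q y := fun y => by
    simpa using (((hasDerivAt_id y).sub_const b).const_mul q).const_add p
  have hk : ∀ y, HasDerivAt (fun y => κ ((y - b) / δ)) (κ₁ ((y - b) / δ) * (1 / δ)) y := fun y =>
    (hκ.hasDerivAt _).comp y (hlin y)
  have hk₁ : ∀ y, HasDerivAt (fun y => κ₁ ((y - b) / δ)) (κ₂ ((y - b) / δ) * (1 / δ)) y := fun y =>
    (hκ.hasDerivAt' _).comp y (hlin y)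
  refine ⟨fun y => κ ((y - b) / δ) * (p + q * (y - b)),
    fun y => κ₁ ((y - b) / δ) * (1 / δ) * (p + q * (y - b)) + κ ((y - b) / δ) * q,
    fun y => κ₂ ((y - b) / δ) * (1 / δ) * (1 / δ) * (p + q * (y - b)) +
      κ₁ ((y - b) / δ) * (1 / δ) * q + κ₁ ((y - b) / δ) * (1 / δ) * q, ⟨fun y => ?_, fun y => ?_, ?_⟩,
      fun y => ?_, fun y hy => ?_, fun y hy => ?_⟩
  · exact (hk y).mul (haff y)
  · exact (((hk₁ y).mul_const (1 / δ)).mul (haff y)).add ((hk y).mul_const q)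
  · have := hκ.continuous
    have h₁ : Continuous κ₁ := continuous_iff_continuousAt.2
      fun y => (hκ.hasDerivAt' y).continuousAt
    fun_prop
  · rcases le_total y b with hy | hy
    · simp only [h0 _ (hleft y hy)]
      simp only [zero_mul, add_zero, abs_zero]
      positivity
    rcases le_total a y with hy' | hy'
    · simp only [h1 _ (hright y hy')]
      simp only [zero_mul, add_zero, abs_zero]
      positivity
    obtain ⟨-, hb1, hb2⟩ := hbd ((y - b) / δ)
    have hq' : |q * (y - b)| ≤ M * δ * δ := by
      rw [abs_mul]
      gcongr
      rw [abs_of_nonneg (by linarith)]; linarith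
    have hpq : |p + q * (y - b)| ≤ 2 * M * δ ^ 2 := by
      refine (abs_add_le _ _).trans ?_
      nlinarith
    have e1 : |κ₂ ((y - b) / δ) * (1 / δ) * (1 / δ) * (p + q * (y - b))| ≤ 2 * B * M := by
      rw [abs_mul, abs_mul, abs_mul, abs_of_pos (one_div_pos.2 hδ)]
      calc _ ≤ B * (1 / δ) * (1 / δ) * (2 * M * δ ^ 2) := by gcongr
        _ = 2 * B * M := by field_simp
    have e2 : |κ₁ ((y - b) / δ) * (1 / δ) * q| ≤ B * M := by
      rw [abs_mul, abs_mul, abs_of_pos (one_div_pos.2 hδ)]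
      calc _ ≤ B * (1 / δ) * (M * δ) := by gcongr
        _ = B * M := by field_simp
    refine (abs_add_le _ _).trans ?_
    have := abs_add_le (κ₂ ((y - b) / δ) * (1 / δ) * (1 / δ) * (p + q * (y - b)))
      (κ₁ ((y - b) / δ) * (1 / δ) * q)
    linarith
  · simp [h0 _ (hleft y hy)]
  · simp [h1 _ (hright y hy)]

/-- One-dimensional Whitney extension for finite data. -/
theorem exists_hermite_interpolant : ∃ B : ℝ, 1 ≤ B ∧ ∀ {ι : Type} [DecidableEq ι] (T : Finset ι)
    (s h m : ι → ℝ) (M : ℝ), 0 ≤ M →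
    (∀ i ∈ T, ∀ j ∈ T, |h j - h i - m i * (s j - s i)| ≤ M * (s j - s i) ^ 2) →
    (∀ i ∈ T, ∀ j ∈ T, |m j - m i| ≤ M * |s j - s i|) →
    ∃ g g₁ g₂ : ℝ → ℝ, IsC2Chain g g₁ g₂ ∧ (∀ y, |g₂ y| ≤ B * M) ∧
      (∀ i ∈ T, g (s i) = h i ∧ g₁ (s i) = m i) := by
  obtain ⟨B, hB, htrans⟩ := exists_affine_transition
  refine ⟨B, hB, fun {ι} _ T s h m M hM => ?_⟩
  have haff : ∀ i : ι, IsC2Chain (fun y => h i + m i * (y - s i)) (fun _ => m i) (fun _ => 0) :=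
    fun i => ⟨fun y => by simpa using (((hasDerivAt_id y).sub_const (s i)).const_mul (m i)).const_add (h i),
      fun y => hasDerivAt_const y _, continuous_const⟩
  suffices H : (∀ i ∈ T, ∀ j ∈ T, |h j - h i - m i * (s j - s i)| ≤ M * (s j - s i) ^ 2) →
    (∀ i ∈ T, ∀ j ∈ T, |m j - m i| ≤ M * |s j - s i|) →
    ∃ g g₁ g₂ : ℝ → ℝ, IsC2Chain g g₁ g₂ ∧ (∀ y, |g₂ y| ≤ B * M) ∧
      (∀ i ∈ T, g (s i) = h i ∧ g₁ (s i) = m i) ∧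
      (∀ i ∈ T, (∀ j ∈ T, s j ≤ s i) →
        ∀ y ≥ s i, g y = h i + m i * (y - s i) ∧ g₁ y = m i ∧ g₂ y = 0) by
    intro h1 h2
    obtain ⟨g, g₁, g₂, k1, k2, k3, -⟩ := H h1 h2
    exact ⟨g, g₁, g₂, k1, k2, k3⟩
  induction T using Finset.induction_on_max_value s with
  | empty =>
    intro _ _
    exact ⟨fun _ => 0, fun _ => 0, fun _ => 0, ⟨fun y => hasDerivAt_const y _,
      fun y => hasDerivAt_const y _, continuous_const⟩, fun y => by simp; positivity, by simp, by simp⟩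
  | insert a T haT hmax ih =>
    intro hw hw'
    obtain ⟨g, g₁, g₂, hg, hg2, hint, htop⟩ := ih
      (fun i hi j hj => hw i (Finset.mem_insert_of_mem hi) j (Finset.mem_insert_of_mem hj))
      (fun i hi j hj => hw' i (Finset.mem_insert_of_mem hi) j (Finset.mem_insert_of_mem hj))
    rcases T.eq_empty_or_nonempty with rfl | hT
    · exact ⟨_, _, _, haff a, fun y => by simp; positivity, by simp, by simp⟩
    obtain ⟨b, hbT, hb⟩ := T.exists_max_image s hT
    have ha := Finset.mem_insert_self a T
    have hb' : b ∈ insert a T := Finset.mem_insert_of_mem hbT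
    have w1 := hw a ha b hb'
    have w2 := hw' b hb' a ha
    rcases (hmax b hbT).eq_or_lt with hab | hab
    · have e1 : h a = h b := by
        rw [hab] at w1
        simp only [sub_self, mul_zero, sub_zero, ne_eq, OfNat.ofNat_ne_zero, not_false_eq_true,
          zero_pow, abs_nonpos_iff] at w1
        linarith
      have e2 : m a = m b := by
        rw [hab] at w2
        simp only [sub_self, abs_zero, mul_zero, abs_nonpos_iff] at w2
        linarith
      refine ⟨g, g₁, g₂, hg, hg2, fun i hi => ?_, fun i hi hi' => ?_⟩
      · rcases Finset.mem_insert.1 hi with rfl | hi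
        · rw [← hab, e1, e2]; exact hint b hbT
        · exact hint i hi
      · rcases Finset.mem_insert.1 hi with rfl | hi
        · rw [← hab, e1, e2]; exact htop b hbT hb
        · exact htop i hi fun j hj => hi' j (Finset.mem_insert_of_mem hj)
    · obtain ⟨f, f₁, f₂, hf, hf2, hf0, hf1⟩ := htrans (s a) (s b)
        (h a - m a * (s a - s b) - h b) (m a - m b) M hab hM
        (by
          calc _ = |h b - h a - m a * (s b - s a)| := by rw [← abs_neg]; ring_nf
            _ ≤ _ := w1
            _ = _ := by ring)
        (by rwa [abs_of_pos (sub_pos.2 hab)] at w2)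
      have hbt := htop b hbT hb
      refine ⟨_, _, _, hg.add hf, fun y => ?_, fun i hi => ?_, fun i hi hi' y hy => ?_⟩
      · rcases le_total y (s b) with hy | hy
        · simpa only [(hf0 y hy).2.2, add_zero] using hg2 y
        · simpa only [(hbt y hy).2.2, zero_add] using hf2 y
      · rcases Finset.mem_insert.1 hi with rfl | hi
        · simp only [hf1 _ le_rfl, hbt _ hab.le]
          constructor <;> ring
        · simpa only [hf0 _ (hb i hi), add_zero] using hint i hi
      · have hia : i = a := by
          rcases Finset.mem_insert.1 hi with h | h
          · exact h
          · linarith [hb i h, hi' a ha]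
        subst hia
        simp only [hf1 y hy, hbt y (hab.le.trans hy)]
        refine ⟨by ring, by ring, by ring⟩

/-- All derivatives of `f` of order at most two are bounded by `C` at `z`. -/
def C2BoundAt (f : E2 → ℝ) (z : E2) (C : ℝ) : Prop :=
  ∀ i : ℕ, i ≤ 2 → ‖iteratedFDeriv ℝ i f z‖ ≤ C

namespace C2BoundAt

variable {f g : E2 → ℝ} {z : E2} {A B C : ℝ}

theorem iff_fderiv :
    C2BoundAt f z C ↔ |f z| ≤ C ∧ ‖fderiv ℝ f z‖ ≤ C ∧ ‖fderiv ℝ (fderiv ℝ f) z‖ ≤ C := by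
  have h2 : ‖iteratedFDeriv ℝ 2 f z‖ = ‖fderiv ℝ (fderiv ℝ f) z‖ := by
    rw [← norm_iteratedFDeriv_fderiv, norm_iteratedFDeriv_one]
  constructor
  · intro h
    refine ⟨?_, ?_, ?_⟩
    · simpa using h 0 (by norm_num)
    · simpa [norm_iteratedFDeriv_one] using h 1 (by norm_num)
    · simpa [h2] using h 2 le_rfl
  · rintro ⟨h0, h1, h2'⟩ i hi
    interval_cases i
    · simpa using h0
    · simpa [norm_iteratedFDeriv_one] using h1
    · rwa [h2]

theorem of_hasFDerivAt {f' : E2 → E2 →L[ℝ] ℝ} {L : E2 →L[ℝ] E2 →L[ℝ] ℝ}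
    (hf : ∀ y, HasFDerivAt f (f' y) y) (hf' : HasFDerivAt f' L z)
    (h0 : |f z| ≤ C) (h1 : ‖f' z‖ ≤ C) (h2 : ‖L‖ ≤ C) : C2BoundAt f z C := by
  have e : fderiv ℝ f = f' := funext fun y => (hf y).fderiv
  rw [iff_fderiv, e, hf'.fderiv]
  exact ⟨h0, h1, h2⟩

theorem mono (h : C2BoundAt f z A) (hAB : A ≤ B) : C2BoundAt f z B :=
  fun i hi => (h i hi).trans hAB

theorem nonneg (h : C2BoundAt f z A) : 0 ≤ A := (norm_nonneg _).trans (h 0 (by norm_num))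

theorem mul (hf : ContDiff ℝ 2 f) (hg : ContDiff ℝ 2 g) (hA : C2BoundAt f z A)
    (hB : C2BoundAt g z B) : C2BoundAt (fun y => f y * g y) z (4 * A * B) := by
  intro i hi
  have hA0 := hA.nonneg
  have hB0 := hB.nonneg
  refine (norm_iteratedFDeriv_mul_le hf hg z (n := i) (by exact_mod_cast hi)).trans ?_
  calc _ ≤ ∑ j ∈ Finset.range (i + 1), (i.choose j : ℝ) * A * B := by
        refine Finset.sum_le_sum fun j hj => ?_
        have hj' := Finset.mem_range.1 hj
        have h1 := hA j (by omega)
        have h2 := hB (i - j) (by omega)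
        gcongr
    _ = 2 ^ i * (A * B) := by
        simp_rw [mul_assoc]
        rw [← Finset.sum_mul]
        congr 1
        exact_mod_cast Nat.sum_range_choose i
    _ ≤ 2 ^ 2 * (A * B) := by gcongr; norm_num
    _ = 4 * A * B := by ring

theorem const_add_clm {c : ℝ} {l : E2 →L[ℝ] ℝ} (hc : |c| ≤ A) (hl : ‖l‖ ≤ A) (hz : ‖z‖ ≤ 1) :
    C2BoundAt (fun y => c + l y) z (2 * A) := by
  have hA0 : 0 ≤ A := (abs_nonneg _).trans hc
  refine of_hasFDerivAt (f' := fun _ => l) (L := 0) (fun y => l.hasFDerivAt.const_add c)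
    (hasFDerivAt_const l z) ?_ (by linarith) (ContinuousLinearMap.opNorm_zero.le.trans (by positivity))
  refine (abs_add_le _ _).trans ?_
  have : |l z| ≤ A * 1 := (l.le_opNorm z).trans (by gcongr)
  linarith

theorem exists_of (f : E2 → ℝ) (z : E2) : ∃ C, C2BoundAt f z C :=
  ⟨_, iff_fderiv.2 ⟨le_max_left _ _, (le_max_left _ _).trans (le_max_right _ _),
    (le_max_right _ _).trans (le_max_right _ _)⟩⟩

/-- The rescaling `z ↦ ρ² f((z - x) / ρ)` preserves `C²` bounds when `ρ ≤ 1`. -/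
theorem rescale {ρ : ℝ} (hρ : 0 < ρ) (hρ1 : ρ ≤ 1) (hf : ContDiff ℝ 2 f)
    (h : ∀ y, C2BoundAt f y C) (x z : E2) :
    C2BoundAt (fun y => ρ ^ 2 * f (ρ⁻¹ • (y - x))) z C := by
  have hd : Differentiable ℝ f := hf.differentiable (by norm_num)
  have hd' : Differentiable ℝ (fderiv ℝ f) :=
    (hf.fderiv_right (m := 1) (by norm_num [one_add_one_eq_two])).differentiable (by norm_num)
  have hC := (h z).nonneg
  have hin : ∀ y, HasFDerivAt (fun y : E2 => ρ⁻¹ • (y - x)) (ρ⁻¹ • ContinuousLinearMap.id ℝ E2) y :=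
    fun y => ((hasFDerivAt_id y).sub_const x).const_smul ρ⁻¹
  obtain ⟨h0, h1, h2⟩ := iff_fderiv.1 (h (ρ⁻¹ • (z - x)))
  have hρ2 : ρ ^ 2 ≤ 1 := pow_le_one₀ hρ.le hρ1
  refine of_hasFDerivAt (f' := fun y => ρ • fderiv ℝ f (ρ⁻¹ • (y - x)))
    (L := fderiv ℝ (fderiv ℝ f) (ρ⁻¹ • (z - x))) (fun y => ?_) ?_ ?_ ?_ h2
  · have := ((hd _).hasFDerivAt.comp y (hin y)).const_mul (ρ ^ 2)
    refine this.congr_fderiv ?_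
    ext v
    simp only [_root_.smul_apply, ContinuousLinearMap.comp_apply,
      ContinuousLinearMap.id_apply, map_smul, smul_eq_mul]
    field_simp
  · have := ((hd' _).hasFDerivAt.comp z (hin z)).const_smul ρ
    refine this.congr_fderiv ?_
    ext v u
    simp only [_root_.smul_apply, ContinuousLinearMap.comp_apply,
      ContinuousLinearMap.id_apply, map_smul, smul_eq_mul]
    field_simp
  · rw [abs_mul, abs_of_pos (by positivity)]
    nlinarith [abs_nonneg (f (ρ⁻¹ • (z - x)))]
  · rw [norm_smul, Real.norm_eq_abs, abs_of_pos hρ]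
    nlinarith [norm_nonneg (fderiv ℝ f (ρ⁻¹ • (z - x)))]

end C2BoundAt

/-- A smooth cutoff at the origin, with `C²` bounds depending only on the radius. -/
theorem exists_cutoff {δ : ℝ} (hδ : 0 < δ) : ∃ (θ : E2 → ℝ) (C : ℝ), ContDiff ℝ 2 θ ∧
    (∀ z, C2BoundAt θ z C) ∧ θ =ᶠ[nhds 0] 1 ∧ (∀ z, δ ≤ ‖z‖ → θ z = 0) ∧
    ∀ z, δ < ‖z‖ → C2BoundAt θ z 0 := by
  let b : ContDiffBump (0 : E2) := ⟨δ / 2, δ, by positivity, by linarith⟩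
  have hb : ContDiff ℝ 2 b := b.contDiff (n := 2)
  have hbd : ∀ i : ℕ, i ≤ 2 → ∃ C, ∀ z, ‖iteratedFDeriv ℝ i b z‖ ≤ C := fun i hi =>
    (hb.continuous_iteratedFDeriv (by exact_mod_cast hi)).bounded_above_of_compact_support
      (b.hasCompactSupport.iteratedFDeriv i)
  choose! C hC using hbd
  refine ⟨b, |C 0| + |C 1| + |C 2|, hb, fun z i hi => (hC i hi z).trans ?_, b.eventuallyEq_one,
    fun z hz => b.zero_of_le_dist (by simpa using hz), fun z hz i _ => ?_⟩
  · have h0 := abs_nonneg (C 0)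
    have h1 := abs_nonneg (C 1)
    have h2 := abs_nonneg (C 2)
    refine (le_abs_self _).trans ?_
    interval_cases i <;> linarith
  · have : z ∉ tsupport b := by
      rw [b.tsupport_eq]
      simpa using hz
    rw [norm_le_zero_iff]
    exact Function.notMem_support.1 fun h => this (support_iteratedFDeriv_subset i h)

/-- Multiplication by a cutoff makes local `C²` bounds global. -/
theorem exists_cutoff_mul {δ : ℝ} (hδ : 0 < δ) (A : ℝ) : ∃ C : ℝ, ∀ f : E2 → ℝ, ContDiff ℝ 2 f →
    (∀ z, ‖z‖ ≤ δ → C2BoundAt f z A) →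
    ∃ G : E2 → ℝ, ContDiff ℝ 2 G ∧ (∀ z, C2BoundAt G z C) ∧ G =ᶠ[nhds 0] f ∧
      (∀ z, f z = 0 → G z = 0) ∧ ∀ z, δ ≤ ‖z‖ → G z = 0 := by
  obtain ⟨θ, C, hθ, hC, h1, h0, hout⟩ := exists_cutoff hδ
  refine ⟨4 * C * A, fun f hf hA => ⟨fun y => θ y * f y, hθ.mul hf, fun z => ?_, ?_,
    fun z hz => by simp [hz], fun z hz => by simp [h0 z hz]⟩⟩
  · rcases le_or_gt ‖z‖ δ with hz | hz
    · exact (hC z).mul hθ hf (hA z hz)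
    · obtain ⟨B, hB⟩ := C2BoundAt.exists_of f z
      refine ((hout z hz).mul hθ hf hB).mono ?_
      have := (hC 0).nonneg
      have := (hA 0 (by simpa using hδ.le)).nonneg
      simp only [mul_zero, zero_mul]
      positivity
  · filter_upwards [h1] with z hz
    simp [hz]

/-- `D` is a `1`-Lipschitz field of gradients for `G` with quadratic Taylor remainder. -/
structure IsWhitneyField (G : E2 → ℝ) (D : E2 → E2 →L[ℝ] ℝ) : Prop where
  lipschitz : ∀ z w, ‖D w - D z‖ ≤ ‖w - z‖
  taylor : ∀ z w, |G w - G z - D z (w - z)| ≤ ‖w - z‖ ^ 2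

theorem IsWhitneyField.of_contDiff {f : E2 → ℝ} (hf : ContDiff ℝ 2 f)
    (h : ∀ z, C2BoundAt f z 1) : IsWhitneyField f (fderiv ℝ f) := by
  have hd : Differentiable ℝ f := hf.differentiable (by norm_num)
  have hd' : Differentiable ℝ (fderiv ℝ f) :=
    (hf.fderiv_right (m := 1) (by norm_num [one_add_one_eq_two])).differentiable (by norm_num)
  have hlip : ∀ z w, ‖fderiv ℝ f w - fderiv ℝ f z‖ ≤ ‖w - z‖ := fun z w => by
    simpa using Convex.norm_image_sub_le_of_norm_fderiv_le (s := Set.univ) (C := 1)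
      (fun y _ => hd' y) (fun y _ => (C2BoundAt.iff_fderiv.1 (h y)).2.2) convex_univ
      (Set.mem_univ z) (Set.mem_univ w)
  refine ⟨hlip, fun z w => ?_⟩
  have := Convex.norm_image_sub_le_of_norm_hasFDerivWithin_le' (f := f) (f' := fderiv ℝ f)
    (φ := fderiv ℝ f z) (C := ‖w - z‖) (s := segment ℝ z w)
    (fun y _ => (hd y).hasFDerivAt.hasFDerivWithinAt)
    (fun y hy => (hlip z y).trans (norm_sub_le_of_mem_segment hy)) (convex_segment z w)
    (left_mem_segment ℝ z w) (right_mem_segment ℝ z w)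
  rwa [Real.norm_eq_abs, ← sq] at this

theorem IsWhitneyField.rescale {G : E2 → ℝ} {D : E2 → E2 →L[ℝ] ℝ} (h : IsWhitneyField G D)
    {ρ : ℝ} (hρ : 0 < ρ) (x : E2) :
    IsWhitneyField (fun z => (ρ ^ 2)⁻¹ * G (x + ρ • z)) (fun z => ρ⁻¹ • D (x + ρ • z)) := by
  have hn : ∀ z w : E2, ‖(x + ρ • w) - (x + ρ • z)‖ = ρ * ‖w - z‖ := fun z w => by
    rw [add_sub_add_left_eq_sub, ← smul_sub, norm_smul, Real.norm_eq_abs, abs_of_pos hρ]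
  refine ⟨fun z w => ?_, fun z w => ?_⟩
  · have e : ρ⁻¹ • D (x + ρ • w) - ρ⁻¹ • D (x + ρ • z) =
        ρ⁻¹ • (D (x + ρ • w) - D (x + ρ • z)) := (smul_sub _ _ _).symm
    rw [e, norm_smul, norm_inv, Real.norm_eq_abs, abs_of_pos hρ, inv_mul_le_iff₀ hρ, ← hn]
    exact h.lipschitz _ _
  · have := h.taylor (x + ρ • z) (x + ρ • w)
    rw [hn, add_sub_add_left_eq_sub, ← smul_sub, map_smul, smul_eq_mul] at this
    rw [_root_.smul_apply, smul_eq_mul]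
    have e : (ρ ^ 2)⁻¹ * G (x + ρ • w) - (ρ ^ 2)⁻¹ * G (x + ρ • z) -
        ρ⁻¹ * (D (x + ρ • z)) (w - z) = (ρ ^ 2)⁻¹ *
        (G (x + ρ • w) - G (x + ρ • z) - ρ * (D (x + ρ • z)) (w - z)) := by
      field_simp
    rw [e, abs_mul, abs_of_pos (by positivity), inv_mul_le_iff₀ (by positivity)]
    linarith [mul_pow ρ ‖w - z‖ 2]

/-- `σ`, `τ` are the coordinates of the orthonormal basis `w`, `v`. -/
structure IsFrame (σ τ : E2 →L[ℝ] ℝ) (w v : E2) : Prop where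
  decomp : ∀ z, z = σ z • w + τ z • v
  norm_sq : ∀ z, ‖z‖ ^ 2 = σ z ^ 2 + τ z ^ 2
  norm_w : ‖w‖ = 1
  norm_v : ‖v‖ = 1
  τ_v : τ v = 1
  τ_w : τ w = 0

theorem exists_isFrame {e : E2 →L[ℝ] ℝ} (he : ‖e‖ = 1) : ∃ σ w v, IsFrame σ e w v := by
  set u : E2 := (InnerProductSpace.toDual ℝ E2).symm e with hu
  have hun : ‖u‖ = 1 := by simpa [hu] using he
  have hu2 : u 0 ^ 2 + u 1 ^ 2 = 1 := by
    have := EuclideanSpace.real_norm_sq_eq u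
    rw [hun, Fin.sum_univ_two] at this
    linarith
  have hez : ∀ z, e z = u 0 * z 0 + u 1 * z 1 := fun z => by
    have : inner ℝ u z = e z := InnerProductSpace.toDual_symm_apply
    rw [← this, PiLp.inner_apply, Fin.sum_univ_two]
    simp only [RCLike.inner_apply, conj_trivial]
    ring
  set w : E2 := !₂[-u 1, u 0] with hw
  have hsz : ∀ z, innerSL ℝ w z = -u 1 * z 0 + u 0 * z 1 := fun z => by
    rw [innerSL_apply_apply, PiLp.inner_apply, Fin.sum_univ_two]
    simp [hw]
    ring
  refine ⟨innerSL ℝ w, w, u, ?_, ?_, ?_, hun, ?_, ?_⟩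
  · intro z
    ext i
    rw [hsz, hez]
    fin_cases i
    · simp [hw]; linear_combination (-z 0) * hu2
    · simp [hw]; linear_combination (-z 1) * hu2
  · intro z
    rw [hsz, hez, EuclideanSpace.real_norm_sq_eq, Fin.sum_univ_two]
    linear_combination (-z 0 ^ 2 - z 1 ^ 2) * hu2
  · have := EuclideanSpace.real_norm_sq_eq w
    rw [Fin.sum_univ_two] at this
    have h1 : ‖w‖ ^ 2 = 1 := by
      rw [this]; simp [hw]; linarith
    nlinarith [norm_nonneg w]
  · rw [hez]; linarith
  · rw [hez]; simp [hw]; ring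

namespace IsFrame

variable {σ τ : E2 →L[ℝ] ℝ} {w v : E2} {α : ℝ} {G : E2 → ℝ} {D : E2 → E2 →L[ℝ] ℝ} {z : E2}

theorem norm_le (hf : IsFrame σ τ w v) (z : E2) : ‖z‖ ≤ |σ z| + |τ z| := by
  refine abs_le_of_sq_le_sq' ?_ (by positivity) |>.2
  rw [hf.norm_sq, add_sq, sq_abs, sq_abs]
  have := mul_nonneg (abs_nonneg (σ z)) (abs_nonneg (τ z))
  linarith

theorem abs_fst_le (hf : IsFrame σ τ w v) (z : E2) : |σ z| ≤ ‖z‖ :=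
  abs_le_of_sq_le_sq (by rw [hf.norm_sq]; nlinarith [sq_nonneg (τ z)]) (norm_nonneg z)

theorem abs_snd_le (hf : IsFrame σ τ w v) (z : E2) : |τ z| ≤ ‖z‖ :=
  abs_le_of_sq_le_sq (by rw [hf.norm_sq]; nlinarith [sq_nonneg (σ z)]) (norm_nonneg z)

theorem norm_fst_le (hf : IsFrame σ τ w v) : ‖σ‖ ≤ 1 :=
  σ.opNorm_le_bound zero_le_one fun z => by simpa using hf.abs_fst_le z

theorem zero_near_line (hf : IsFrame σ τ w v) (hG : IsWhitneyField G D) (h0 : G 0 = α)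
    (hD : D 0 = τ) (hz : ‖z‖ ≤ 1 / 8) (hGz : G z = 0) :
    |τ z + α| ≤ 4 * (σ z ^ 2 + α ^ 2) ∧ ‖z‖ ≤ 2 * (|σ z| + |α|) := by
  have h1 := hG.taylor 0 z
  rw [h0, hD, hGz, sub_zero, hf.norm_sq, ← abs_neg] at h1
  have e : -(0 - α - τ z) = τ z + α := by ring
  rw [e] at h1
  have hs := (hf.abs_fst_le z).trans hz
  have ht := (hf.abs_snd_le z).trans hz
  have hn := hf.norm_le z
  rw [← sq_abs (σ z), ← sq_abs (τ z)] at h1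
  rw [← sq_abs (σ z), ← sq_abs α]
  have h2 : |τ z| ≤ |τ z + α| + |α| := by
    simpa using abs_sub (τ z + α) α
  have hs0 := abs_nonneg (σ z)
  have ht0 := abs_nonneg (τ z)
  have ha0 := abs_nonneg α
  generalize |σ z| = s at *
  generalize |τ z| = t at *
  generalize |α| = a at *
  have h3 : 7 / 8 * t ≤ a + s ^ 2 := by nlinarith
  have h4 : s ^ 2 ≤ s / 8 := by nlinarith
  refine ⟨?_, by linarith⟩
  have h5 : (7 / 8 * t) ^ 2 ≤ (a + s ^ 2) ^ 2 := pow_le_pow_left₀ (by positivity) h3 2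
  have h6 : (a + s ^ 2) ^ 2 ≤ 2 * a ^ 2 + 2 * (s ^ 2) ^ 2 := by nlinarith [sq_nonneg (a - s ^ 2)]
  have h7 : (s ^ 2) ^ 2 ≤ s ^ 2 / 64 := by nlinarith
  nlinarith

theorem exists_slope (hf : IsFrame σ τ w v) (hG : IsWhitneyField G D) (h0 : G 0 = α)
    (hD : D 0 = τ) (hz : ‖z‖ ≤ 1 / 8) (hGz : G z = 0) :
    ∃ m : ℝ, |m| ≤ 3 * (|σ z| + |α|) ∧ ∀ z', ‖z'‖ ≤ 1 / 8 → G z' = 0 →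
      |τ z' - τ z - m * (σ z' - σ z)| ≤ 3 * (σ z' - σ z) ^ 2 := by
  have hzn := (hf.zero_near_line hG h0 hD hz hGz).2
  have hlip : ‖D z - τ‖ ≤ ‖z‖ := by simpa [hD] using hG.lipschitz 0 z
  have hv : |D z v - 1| ≤ ‖z‖ := by
    simpa [hf.τ_v, hf.norm_v] using (D z - τ).le_of_opNorm_le hlip v
  have hw : |D z w| ≤ ‖z‖ := by
    simpa [hf.τ_w, hf.norm_w] using (D z - τ).le_of_opNorm_le hlip w
  have hv' : 7 / 8 ≤ D z v := by linarith [(abs_le.1 hv).1]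
  have hvpos : 0 < D z v := by linarith
  have hm : |-(D z w) / D z v| ≤ 8 / 7 * ‖z‖ := by
    rw [abs_div, abs_neg, abs_of_pos hvpos, div_le_iff₀ hvpos]
    nlinarith [norm_nonneg z]
  refine ⟨-(D z w) / D z v, ?_, fun z' hz' hGz' => ?_⟩
  · have := abs_nonneg (σ z)
    have := abs_nonneg α
    linarith
  have ht := hG.taylor z z'
  rw [hGz, hGz', sub_zero, zero_sub, abs_neg] at ht
  have hdec : D z (z' - z) = σ (z' - z) * D z w + τ (z' - z) * D z v := by
    conv_lhs => rw [hf.decomp (z' - z)]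
    simp
  rw [← map_sub, ← map_sub]
  have hn := hf.norm_le (z' - z)
  have hnsq := hf.norm_sq (z' - z)
  have hn4 : ‖z' - z‖ ≤ 1 / 4 := (norm_sub_le _ _).trans (by linarith)
  set y := z' - z with hy
  have hbd : |τ y - -(D z w) / D z v * σ y| ≤ 8 / 7 * ‖y‖ ^ 2 := by
    have e : τ y - -(D z w) / D z v * σ y = D z y / D z v := by
      rw [hdec]; field_simp; ring
    rw [e, abs_div, abs_of_pos hvpos, div_le_iff₀ hvpos]
    nlinarith [sq_nonneg ‖y‖]
  refine hbd.trans ?_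
  have h1 : |τ y| ≤ |τ y - -(D z w) / D z v * σ y| + |-(D z w) / D z v| * |σ y| := by
    rw [← abs_mul]
    simpa using abs_add_le (τ y - -(D z w) / D z v * σ y) (-(D z w) / D z v * σ y)
  have h2 : |-(D z w) / D z v| * |σ y| ≤ 1 / 7 * |σ y| := by
    gcongr
    linarith
  have h3 : ‖y‖ ^ 2 ≤ 1 / 4 * (|σ y| + |τ y|) := by nlinarith [norm_nonneg y]
  have h4 : |τ y| ≤ |σ y| := by linarith [abs_nonneg (σ y)]
  have h5 : τ y ^ 2 ≤ σ y ^ 2 := sq_le_sq.2 h4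
  nlinarith [sq_nonneg (σ y)]

end IsFrame

/-- Every at most three points of `E` lie on the zero set of a Whitney field with the prescribed
value and gradient at the origin. -/
def HasLocalFields (E : Finset E2) (α : ℝ) (e : E2 →L[ℝ] ℝ) : Prop :=
  ∀ S ⊆ E, S.card ≤ 3 → ∃ G D, IsWhitneyField G D ∧ G 0 = α ∧ D 0 = e ∧ ∀ z ∈ S, G z = 0

/-- There is a `C²` function with norm at most `C` and the prescribed value and gradient at `x`
that vanishes on `E`. -/
def HasExtensionAt (E : Finset E2) (x : E2) (α : ℝ) (e : E2 →L[ℝ] ℝ) (C : ℝ) : Prop :=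
  ∃ G : E2 → ℝ, ContDiff ℝ 2 G ∧ (∀ z, C2BoundAt G z C) ∧ G x = α ∧ fderiv ℝ G x = e ∧
    ∀ z ∈ E, G z = 0

theorem convex_setOf_abs_sub_mul_le (c d r : ℝ) : Convex ℝ {m : ℝ | |c - m * d| ≤ r} := by
  intro x hx y hy a b ha hb hab
  have e : c - (a • x + b • y) * d = a * (c - x * d) + b * (c - y * d) := by
    simp only [smul_eq_mul]
    linear_combination (-c) * hab
  simp only [Set.mem_ofPred_eq] at hx hy ⊢
  rw [e]
  calc _ ≤ |a * (c - x * d)| + |b * (c - y * d)| := abs_add_le _ _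
    _ = a * |c - x * d| + b * |c - y * d| := by
      rw [abs_mul, abs_mul, abs_of_nonneg ha, abs_of_nonneg hb]
    _ ≤ a * r + b * r := by gcongr
    _ = r := by rw [← add_mul, hab, one_mul]

/-- By Helly's theorem, the slopes at a point can be chosen compatibly with all other points. -/
theorem exists_common_slope {σ τ : E2 →L[ℝ] ℝ} {w v : E2} (hf : IsFrame σ τ w v) {E : Finset E2}
    {α : ℝ} (hE : ∀ z ∈ E, ‖z‖ ≤ 1 / 8) (h : HasLocalFields E α τ) {z : E2} (hz : z ∈ E) :
    ∃ m : ℝ, |m| ≤ 3 * (|σ z| + |α|) ∧ ∀ z' ∈ E,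
      |τ z' - τ z - m * (σ z' - σ z)| ≤ 3 * (σ z' - σ z) ^ 2 := by
  classical
  obtain ⟨m, hm⟩ := Convex.helly_theorem' (𝕜 := ℝ) (s := E)
    (F := fun z' => {m : ℝ | |0 - m * 1| ≤ 3 * (|σ z| + |α|)} ∩
      {m : ℝ | |τ z' - τ z - m * (σ z' - σ z)| ≤ 3 * (σ z' - σ z) ^ 2})
    (fun z' _ => (convex_setOf_abs_sub_mul_le _ _ _).inter (convex_setOf_abs_sub_mul_le _ _ _))
    (fun I hI hcard => by
      rw [Module.finrank_self] at hcard
      obtain ⟨G, D, hG, h0, hD, hS⟩ := h (insert z I) (Finset.insert_subset hz hI)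
        ((Finset.card_insert_le _ _).trans (by omega))
      obtain ⟨m, hm, hm'⟩ := hf.exists_slope hG h0 hD (hE z hz) (hS z (Finset.mem_insert_self _ _))
      refine ⟨m, Set.mem_iInter₂.2 fun z' hz' => ⟨by simpa using hm,
        hm' z' (hE z' (hI hz')) (hS z' (Finset.mem_insert_of_mem hz'))⟩⟩)
  have hm' := Set.mem_iInter₂.1 hm
  exact ⟨m, by simpa using (hm' z hz).1, fun z' hz' => (hm' z' hz').2⟩

/-- The points of `E` near the origin lie on a `C²` graph that is nearly tangent to the prescribed
jet at the origin. -/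
theorem exists_graph : ∃ K : ℝ, 1 ≤ K ∧ ∀ {σ τ : E2 →L[ℝ] ℝ} {w v : E2}, IsFrame σ τ w v →
    ∀ (E : Finset E2) (α : ℝ), (∀ z ∈ E, ‖z‖ ≤ 1 / 8) → HasLocalFields E α τ →
    ∃ g g₁ g₂ : ℝ → ℝ, IsC2Chain g g₁ g₂ ∧ (∀ y, |g₂ y| ≤ K) ∧ (∀ z ∈ E, g (σ z) = τ z) ∧
      |g 0 + α| ≤ K * α ^ 2 ∧ |g₁ 0| ≤ K * |α| := by
  classical
  obtain ⟨B, hB, hint⟩ := exists_hermite_interpolant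
  refine ⟨14 + B * 14, by linarith, fun {σ τ w v} hf E α hE h => ?_⟩
  have hK : ∀ {y}, y ≤ B * 14 → y ≤ 14 + B * 14 := fun h => by linarith
  choose! m hm hm' using fun z hz => exists_common_slope hf hE h (z := z) hz
  have hnear : ∀ z ∈ E, |τ z + α| ≤ 4 * (σ z ^ 2 + α ^ 2) := fun z hz => by
    obtain ⟨G, D, hG, h0, hD, hS⟩ := h {z} (by simpa using hz) (by simp)
    exact (hf.zero_near_line hG h0 hD (hE z hz) (hS z (by simp))).1
  have hinj : ∀ i ∈ E, ∀ j ∈ E, σ i = σ j → i = j := fun i hi j hj hij => by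
    have := hm' i hi j hj
    rw [hij] at this
    simp only [sub_self, mul_zero, sub_zero, ne_eq, OfNat.ofNat_ne_zero, not_false_eq_true,
      zero_pow, abs_nonpos_iff, sub_eq_zero] at this
    rw [hf.decomp i, hf.decomp j, hij, this]
  have hmm : ∀ i ∈ E, ∀ j ∈ E, |m j - m i| ≤ 6 * |σ j - σ i| := fun i hi j hj => by
    by_cases hij : σ i = σ j
    · rw [hinj i hi j hj hij]; simp
    have hpos : 0 < |σ j - σ i| := abs_pos.2 (sub_ne_zero.2 (Ne.symm hij))
    have h1 := hm' i hi j hj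
    have h2 := hm' j hj i hi
    refine le_of_mul_le_mul_right ?_ hpos
    rw [← abs_mul]
    calc |(m j - m i) * (σ j - σ i)| = |(τ j - τ i - m i * (σ j - σ i)) +
          (τ i - τ j - m j * (σ i - σ j))| := by congr 1; ring
      _ ≤ 3 * (σ j - σ i) ^ 2 + 3 * (σ i - σ j) ^ 2 := (abs_add_le _ _).trans (add_le_add h1 h2)
      _ = 6 * |σ j - σ i| * |σ j - σ i| := by rw [mul_assoc, abs_mul_abs_self]; ring
  by_cases hfar : ∀ z ∈ E, |α| ≤ |σ z|
  · have hα : ∀ z ∈ E, α ^ 2 ≤ σ z ^ 2 := fun z hz => sq_le_sq.2 (hfar z hz)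
    let T : Finset (Option E2) := insert none (E.image some)
    obtain ⟨g, g₁, g₂, hg, hg2, hgT⟩ := hint T (fun i => i.elim 0 σ) (fun i => i.elim (-α) τ)
      (fun i => i.elim 0 m) 14 (by norm_num)
      (by
        have hE14 : ∀ z ∈ E, |τ z - -α| ≤ 14 * σ z ^ 2 := fun z hz => by
          rw [sub_neg_eq_add]; linarith [hnear z hz, hα z hz, sq_nonneg (σ z)]
        rintro (_ | i) hi (_ | j) hj
        · simp
        · have hj : j ∈ E := by simpa [T] using hj
          simpa using hE14 j hj
        · have hi : i ∈ E := by simpa [T] using hi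
          have h1 := hnear i hi
          have h2 := hα i hi
          have h3 : |m i * σ i| ≤ 6 * σ i ^ 2 := by
            rw [abs_mul, ← sq_abs (σ i)]
            nlinarith [hm i hi, hfar i hi, abs_nonneg (σ i)]
          simp only [Option.elim_none, Option.elim_some]
          calc |-α - τ i - m i * (0 - σ i)| = |m i * σ i - (τ i + α)| := by congr 1; ring
            _ ≤ |m i * σ i| + |τ i + α| := abs_sub _ _
            _ ≤ 14 * (0 - σ i) ^ 2 := by linarith
        · have hi : i ∈ E := by simpa [T] using hi
          have hj : j ∈ E := by simpa [T] using hj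
          simp only [Option.elim_some]
          linarith [hm' i hi j hj, sq_nonneg (σ j - σ i)])
      (by
        have hE6 : ∀ z ∈ E, |m z| ≤ 14 * |σ z| := fun z hz => by
          linarith [hm z hz, hfar z hz, abs_nonneg (σ z)]
        rintro (_ | i) hi (_ | j) hj
        · simp
        · have hj : j ∈ E := by simpa [T] using hj
          simpa using hE6 j hj
        · have hi : i ∈ E := by simpa [T] using hi
          simpa using hE6 i hi
        · have hi : i ∈ E := by simpa [T] using hi
          have hj : j ∈ E := by simpa [T] using hj
          simp only [Option.elim_some]
          linarith [hmm i hi j hj, abs_nonneg (σ j - σ i)])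
    have h0 := hgT none (Finset.mem_insert_self _ _)
    simp only [Option.elim_none] at h0
    refine ⟨g, g₁, g₂, hg, fun y => hK (hg2 y), fun z hz => ?_, ?_, ?_⟩
    · exact (hgT (some z) (Finset.mem_insert_of_mem (Finset.mem_image_of_mem _ hz))).1
    · rw [h0.1]; simp; positivity
    · rw [h0.2]; simp; positivity
  · push Not at hfar
    obtain ⟨z, hz, hzα⟩ := hfar
    obtain ⟨g, g₁, g₂, hg, hg2, hgT⟩ := hint E (fun i => σ i) (fun i => τ i) m 14 (by norm_num)
      (fun i hi j hj => by linarith [hm' i hi j hj, sq_nonneg (σ j - σ i)])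
      (fun i hi j hj => by linarith [hmm i hi j hj, abs_nonneg (σ j - σ i)])
    have t1 := hg.abs_deriv_sub_le hg2 (σ z) 0
    have t2 := hg.abs_sub_taylor_le hg2 (σ z) 0
    rw [(hgT z hz).2] at t1 t2
    rw [(hgT z hz).1] at t2
    have hzm := hm z hz
    have hσ2 : σ z ^ 2 ≤ α ^ 2 := sq_le_sq.2 hzα.le
    have hzn := hnear z hz
    have hmσ : |m z * σ z| ≤ 6 * α ^ 2 := by
      rw [abs_mul, ← sq_abs α]
      nlinarith [abs_nonneg (σ z), abs_nonneg (m z)]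
    rw [zero_sub, neg_sq] at t2
    rw [zero_sub, abs_neg] at t1
    refine ⟨g, g₁, g₂, hg, fun y => hK (hg2 y), fun z hz => (hgT z hz).1, ?_, ?_⟩
    · have t3 : B * 14 * σ z ^ 2 ≤ B * 14 * α ^ 2 := by gcongr
      calc |g 0 + α| = |(g 0 - τ z - m z * -σ z) + (τ z + α) + - (m z * σ z)| := by congr 1; ring
        _ ≤ |g 0 - τ z - m z * -σ z| + |τ z + α| + |m z * σ z| := by
          refine (abs_add_le _ _).trans ?_
          rw [abs_neg]
          gcongr
          exact abs_add_le _ _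
        _ ≤ (14 + B * 14) * α ^ 2 := by linarith
    · have t3 : B * 14 * |σ z| ≤ B * 14 * |α| := by gcongr
      have t4 : |g₁ 0| ≤ |g₁ 0 - m z| + |m z| := by
        simpa using abs_add_le (g₁ 0 - m z) (m z)
      have := abs_nonneg α
      linarith

/-- An affine factor correcting the approximate value `A` and gradient `τ - q σ` to `α` and `τ`. -/
theorem exists_multiplier {σ τ : E2 →L[ℝ] ℝ} (hσ : ‖σ‖ ≤ 1) (hτ : ‖τ‖ ≤ 1) {α A q K : ℝ}
    (hK : 1 ≤ K) (hα : K * |α| ≤ 1 / 2) (hA : |A - α| ≤ K * α ^ 2) (hq : |q| ≤ K * |α|) :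
    ∃ (u₀ : ℝ) (u₁ : E2 →L[ℝ] ℝ), |u₀| ≤ 2 ∧ ‖u₁‖ ≤ 8 * K ∧ u₀ * A = α ∧
      u₀ • (τ - q • σ) + A • u₁ = τ := by
  by_cases h0 : α = 0
  · subst h0
    have hA0 : A = 0 := by simpa using hA
    have hq0 : q = 0 := by simpa using hq
    exact ⟨1, 0, by norm_num, by simp; linarith, by simp [hA0], by simp [hq0]⟩
  have hαpos : 0 < |α| := abs_pos.2 h0
  have hA' : |A - α| ≤ |α| / 2 := by
    rw [← sq_abs] at hA
    nlinarith
  have hAα : |α| / 2 ≤ |A| := by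
    have : |α| ≤ |A| + |A - α| := by simpa using abs_sub A (A - α)
    linarith
  have hApos : 0 < |A| := by linarith
  have hA0 : A ≠ 0 := abs_pos.1 hApos
  have hu : |α / A| ≤ 2 := by
    rw [abs_div, div_le_iff₀ hApos]; linarith
  refine ⟨α / A, A⁻¹ • (τ - (α / A) • (τ - q • σ)), hu, ?_, by field_simp, ?_⟩
  · have e : τ - (α / A) • (τ - q • σ) = ((A - α) / A) • τ + (α / A * q) • σ := by
      ext z
      simp
      field_simp
      ring
    have b1 : ‖((A - α) / A) • τ‖ ≤ 2 * K * |α| := by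
      rw [norm_smul, Real.norm_eq_abs, abs_div]
      calc |A - α| / |A| * ‖τ‖ ≤ |A - α| / |A| * 1 := by gcongr
        _ ≤ 2 * K * |α| := by
          rw [mul_one, div_le_iff₀ hApos]
          rw [← sq_abs] at hA
          nlinarith [mul_pos (by linarith : 0 < K) hαpos]
    have b2 : ‖(α / A * q) • σ‖ ≤ 2 * K * |α| := by
      rw [norm_smul, Real.norm_eq_abs, abs_mul]
      calc |α / A| * |q| * ‖σ‖ ≤ 2 * (K * |α|) * 1 := by gcongr
        _ = 2 * K * |α| := by ring
    rw [norm_smul, norm_inv, Real.norm_eq_abs, inv_mul_le_iff₀ hApos, e]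
    refine (norm_add_le _ _).trans ?_
    nlinarith
  · rw [smul_inv_smul₀ hA0]
    abel

/-- Extension when the gradient at the base point dominates the value. -/
theorem exists_extension_of_unit_gradient : ∃ c C : ℝ, 0 < c ∧
    ∀ (E : Finset E2) (α : ℝ) (e : E2 →L[ℝ] ℝ), ‖e‖ = 1 → |α| ≤ c → HasLocalFields E α e →
    HasExtensionAt E 0 α e C := by
  classical
  obtain ⟨K, hK, hgraph⟩ := exists_graph
  obtain ⟨C, hcut⟩ := exists_cutoff_mul (show (0 : ℝ) < 1 / 8 by norm_num)
    (4 * (2 * (8 * K)) * (5 * K))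
  refine ⟨1 / (2 * K), C, by positivity, fun E α τ hτ hα hE => ?_⟩
  have hα' : K * |α| ≤ 1 / 2 := by
    rw [le_div_iff₀ (by positivity)] at hα; linarith
  obtain ⟨σ, w, v, hf⟩ := exists_isFrame hτ
  obtain ⟨g, g₁, g₂, hg, hg2, hgE, hg0, hg10⟩ := hgraph hf (E.filter (‖·‖ ≤ 1 / 8)) α
    (fun z hz => (Finset.mem_filter.1 hz).2)
    (fun S hS => hE S (hS.trans (Finset.filter_subset _ _)))
  have hA : |-g 0 - α| ≤ K * α ^ 2 := by
    rwa [← abs_neg, neg_sub, sub_neg_eq_add, add_comm]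
  obtain ⟨u₀, u₁, hu₀, hu₁, huA, huD⟩ :=
    exists_multiplier hf.norm_fst_le hτ.le hK hα' hA hg10
  have hgσ : ∀ y, HasFDerivAt (fun y => g (σ y)) (g₁ (σ y) • σ) y := fun y =>
    (hg.hasDerivAt _).comp_hasFDerivAt y σ.hasFDerivAt
  have hH : ∀ y, HasFDerivAt (fun y => τ y - g (σ y)) (τ - g₁ (σ y) • σ) y := fun y =>
    τ.hasFDerivAt.sub (hgσ y)
  have hg1σ : ∀ y, HasFDerivAt (fun y => g₁ (σ y)) (g₂ (σ y) • σ) y := fun y =>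
    (hg.hasDerivAt' _).comp_hasFDerivAt y σ.hasFDerivAt
  have hHd : ContDiff ℝ 2 (fun y => τ y - g (σ y)) := τ.contDiff.sub (hg.contDiff.comp σ.contDiff)
  have hud : ContDiff ℝ 2 (fun y => u₀ + u₁ y) := contDiff_const.add u₁.contDiff
  have hHb : ∀ z, ‖z‖ ≤ 1 / 8 → C2BoundAt (fun y => τ y - g (σ y)) z (5 * K) := fun z hz => by
    have hs := (hf.abs_fst_le z).trans hz
    have ht := (hf.abs_snd_le z).trans hz
    have hs0 := abs_nonneg (σ z)
    have t1 := hg.abs_deriv_sub_le hg2 0 (σ z)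
    have t2 := hg.abs_sub_taylor_le hg2 0 (σ z)
    rw [sub_zero] at t1 t2
    have hα1 : |α| ≤ 1 / 2 := by nlinarith [abs_nonneg α]
    have b1 : |g₁ (σ z)| ≤ 2 * K := by
      have : |g₁ (σ z)| ≤ |g₁ (σ z) - g₁ 0| + |g₁ 0| := by
        simpa using abs_add_le (g₁ (σ z) - g₁ 0) (g₁ 0)
      nlinarith
    have b0 : |g (σ z)| ≤ 4 * K := by
      have h1 : |g 0| ≤ |g 0 + α| + |α| := by simpa using abs_sub (g 0 + α) α
      have h2 : |g (σ z)| ≤ |g (σ z) - g 0 - g₁ 0 * σ z| + |g 0| + |g₁ 0 * σ z| := by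
        calc |g (σ z)| = |(g (σ z) - g 0 - g₁ 0 * σ z) + g 0 + g₁ 0 * σ z| := by congr 1; ring
          _ ≤ _ := (abs_add_le _ _).trans (by gcongr; exact abs_add_le _ _)
      rw [abs_mul] at h2
      have h3 : |g₁ 0| * |σ z| ≤ 1 / 2 * 1 := by
        gcongr <;> linarith
      have h4 : K * σ z ^ 2 ≤ K * 1 := by
        gcongr
        rw [← sq_abs]; nlinarith
      have h5 : K * α ^ 2 ≤ K * 1 := by
        gcongr
        rw [← sq_abs]; nlinarith [abs_nonneg α]
      linarith
    refine C2BoundAt.of_hasFDerivAt hH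
      ((hasFDerivAt_const τ z).sub ((hg1σ z).smul_const σ)) ?_ ?_ ?_
    · exact (abs_sub _ _).trans (by linarith)
    · refine (norm_sub_le _ _).trans ?_
      rw [norm_smul, Real.norm_eq_abs]
      have : |g₁ (σ z)| * ‖σ‖ ≤ 2 * K * 1 := by
        gcongr; exact hf.norm_fst_le
      linarith
    · have : ‖(g₂ (σ z) • σ).smulRight σ‖ ≤ K * 1 * 1 := by
        rw [ContinuousLinearMap.norm_smulRight_apply, norm_smul, Real.norm_eq_abs]
        gcongr
        exacts [hg2 _, hf.norm_fst_le, hf.norm_fst_le]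
      rw [zero_sub]
      refine (ContinuousLinearMap.opNorm_neg _).le.trans (this.trans (by linarith))
  obtain ⟨G, hG, hGC, hGf, hGz, hGout⟩ := hcut (fun y => (u₀ + u₁ y) * (τ y - g (σ y)))
    (hud.mul hHd) (fun z hz => (C2BoundAt.const_add_clm (A := 8 * K) (by linarith) hu₁
      (by linarith)).mul hud hHd (hHb z hz))
  refine ⟨G, hG, hGC, ?_, ?_, fun z hz => ?_⟩
  · rw [hGf.eq_of_nhds]
    simpa using huA
  · rw [hGf.fderiv_eq]
    have := (u₁.hasFDerivAt.const_add u₀ (x := 0)).mul (hH 0)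
    rw [map_zero, map_zero, map_zero, add_zero, zero_sub, huD] at this
    exact this.fderiv
  · rcases le_or_gt ‖z‖ (1 / 8) with h | h
    · refine hGz z ?_
      rw [hgE z (Finset.mem_filter.2 ⟨hz, h⟩)]
      simp
    · exact hGout z h.le

/-- Extension when the value at the base point dominates the gradient. -/
theorem exists_extension_of_unit_value {B : ℝ} (hB : 0 ≤ B) : ∃ C : ℝ,
    ∀ (E : Finset E2) (α : ℝ) (e : E2 →L[ℝ] ℝ), |α| = 1 → ‖e‖ ≤ B → HasLocalFields E α e →
    HasExtensionAt E 0 α e C := by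
  set δ := 1 / (2 * (1 + B)) with hδ
  have hδ0 : 0 < δ := by positivity
  have hδB : δ * (1 + B) = 1 / 2 := by rw [hδ]; field_simp
  have hδ1 : δ ≤ 1 := by nlinarith
  obtain ⟨C, hcut⟩ := exists_cutoff_mul hδ0 (2 * (1 + B))
  refine ⟨C, fun E α e hα he hE => ?_⟩
  obtain ⟨G, hG, hGC, hGf, -, hGout⟩ := hcut (fun y => α + e y) (contDiff_const.add e.contDiff)
    (fun z hz => C2BoundAt.const_add_clm (by linarith) (by linarith) (by linarith))
  refine ⟨G, hG, hGC, ?_, ?_, fun z hz => hGout z ?_⟩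
  · simp [hGf.eq_of_nhds]
  · rw [hGf.fderiv_eq]
    exact (e.hasFDerivAt.const_add α).fderiv
  · by_contra! hlt
    obtain ⟨F, D, hF, h0, hD, hS⟩ := hE {z} (by simpa using hz) (by simp)
    have ht := hF.taylor 0 z
    rw [hS z (by simp), h0, hD, sub_zero] at ht
    have h1 : |e z| ≤ B * δ := (e.le_opNorm z).trans (by gcongr)
    have h2 : |α| ≤ |0 - α - e z| + |e z| := by
      have := abs_add_le (0 - α - e z) (e z)
      simpa using this
    nlinarith [norm_nonneg z]

theorem HasLocalFields.rescale {E : Finset E2} {x : E2} {a ρ : ℝ} {b : E2 →L[ℝ] ℝ} (hρ : 0 < ρ)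
    (h : ∀ S ⊆ E, S.card ≤ 3 → HasExtensionAt S x a b 1) :
    HasLocalFields (E.image fun y => ρ⁻¹ • (y - x)) ((ρ ^ 2)⁻¹ * a) (ρ⁻¹ • b) := by
  intro S hS hcard
  obtain ⟨G, hG, hG1, hGx, hGb, hGS⟩ := h (S.image fun z => x + ρ • z)
    (fun y hy => by
      obtain ⟨z, hz, rfl⟩ := Finset.mem_image.1 hy
      obtain ⟨u, hu, rfl⟩ := Finset.mem_image.1 (hS hz)
      simpa [smul_inv_smul₀ hρ.ne'] using hu) (Finset.card_image_le.trans hcard)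
  refine ⟨_, _, (IsWhitneyField.of_contDiff hG hG1).rescale hρ x, by simp [hGx], by simp [hGb],
    fun z hz => ?_⟩
  simp [hGS _ (Finset.mem_image_of_mem _ hz)]

theorem HasExtensionAt.of_rescale {E : Finset E2} {x : E2} {a ρ C : ℝ} {b : E2 →L[ℝ] ℝ}
    (hρ : 0 < ρ) (hρ1 : ρ ≤ 1) (h : HasExtensionAt (E.image fun y => ρ⁻¹ • (y - x)) 0
      ((ρ ^ 2)⁻¹ * a) (ρ⁻¹ • b) C) : HasExtensionAt E x a b C := by
  obtain ⟨G, hG, hGC, hG0, hGb, hGE⟩ := h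
  refine ⟨fun y => ρ ^ 2 * G (ρ⁻¹ • (y - x)), ?_, C2BoundAt.rescale hρ hρ1 hG hGC x, ?_, ?_,
    fun z hz => ?_⟩
  · exact contDiff_const.mul (hG.comp ((contDiff_id.sub contDiff_const).const_smul ρ⁻¹))
  · simp only [sub_self, smul_zero, hG0]
    field_simp
  · have hin : HasFDerivAt (fun y : E2 => ρ⁻¹ • (y - x)) (ρ⁻¹ • ContinuousLinearMap.id ℝ E2) x :=
      ((hasFDerivAt_id x).sub_const x).const_smul ρ⁻¹
    have hd : HasFDerivAt G (ρ⁻¹ • b) (ρ⁻¹ • (x - x)) := by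
      rw [sub_self, smul_zero, ← hGb]
      exact (hG.differentiable (by norm_num) 0).hasFDerivAt
    have := (hd.comp x hin).const_mul (ρ ^ 2)
    refine (this.congr_fderiv ?_).fderiv
    ext v
    simp only [_root_.smul_apply, ContinuousLinearMap.comp_apply, ContinuousLinearMap.id_apply,
      map_smul, smul_eq_mul]
    field_simp
  · simp [hGE _ (Finset.mem_image_of_mem _ hz)]

/-- Finiteness principle with three points for `C²` functions vanishing on a finite set and having
a prescribed jet at a point. -/
theorem exists_extension : ∃ C : ℝ, 1 ≤ C ∧ ∀ (E : Finset E2) (x : E2) (a : ℝ) (b : E2 →L[ℝ] ℝ),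
    (∀ S ⊆ E, S.card ≤ 3 → HasExtensionAt S x a b 1) → HasExtensionAt E x a b C := by
  obtain ⟨c, C₁, hc, h₁⟩ := exists_extension_of_unit_gradient
  obtain ⟨C₂, h₂⟩ := exists_extension_of_unit_value (B := √(1 / c)) (Real.sqrt_nonneg _)
  have key : ∀ (E : Finset E2) (x : E2) (a : ℝ) (b : E2 →L[ℝ] ℝ),
      (∀ S ⊆ E, S.card ≤ 3 → HasExtensionAt S x a b 1) →
      ∃ C ≤ 1 + |C₁| + |C₂|, HasExtensionAt E x a b C := by
    intro E x a b h
    have p1 := abs_nonneg C₁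
    have p2 := abs_nonneg C₂
    obtain ⟨F, -, hF1, hFx, hFb, -⟩ := h ∅ (by simp) (by simp)
    obtain ⟨ha, hb, -⟩ := C2BoundAt.iff_fderiv.1 (hF1 x)
    rw [hFx] at ha
    rw [hFb] at hb
    rcases lt_or_ge |a| (c * ‖b‖ ^ 2) with hlt | hge
    · have hbpos : 0 < ‖b‖ := by
        rcases (norm_nonneg b).eq_or_lt with h0 | h0
        · rw [← h0] at hlt
          simp at hlt
          exact absurd hlt (abs_nonneg a).not_gt
        · exact h0
      refine ⟨C₁, by linarith [le_abs_self C₁], .of_rescale hbpos hb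
        (h₁ _ _ _ ?_ ?_ (.rescale hbpos h))⟩
      · rw [norm_smul, norm_inv, norm_norm, inv_mul_cancel₀ hbpos.ne']
      · rw [abs_mul, abs_of_pos (by positivity), inv_mul_le_iff₀ (by positivity)]
        linarith
    rcases (abs_nonneg a).eq_or_lt with h0 | hapos
    · have ha0 : a = 0 := abs_eq_zero.1 h0.symm
      have hb0 : b = 0 := by
        rw [← h0] at hge
        have : ‖b‖ ^ 2 ≤ 0 := by nlinarith [sq_nonneg ‖b‖]
        simpa using this
      refine ⟨0, by linarith, fun _ => 0, contDiff_const, fun z => ?_, ha0.symm, by simp [hb0],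
        by simp⟩
      intro i _
      have e : iteratedFDeriv ℝ i (fun _ : E2 => (0 : ℝ)) z = 0 := by simp
      simp [e]
    · have hρ : 0 < √|a| := Real.sqrt_pos.2 hapos
      have hsq : √|a| ^ 2 = |a| := Real.sq_sqrt hapos.le
      refine ⟨C₂, by linarith [le_abs_self C₂], .of_rescale hρ (Real.sqrt_le_one.2 ha)
        (h₂ _ _ _ ?_ ?_ (.rescale hρ h))⟩
      · rw [hsq, abs_mul, abs_of_pos (by positivity), inv_mul_cancel₀ hapos.ne']
      · rw [norm_smul, norm_inv, Real.norm_eq_abs, abs_of_pos hρ, inv_mul_le_iff₀ hρ,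
          ← Real.sqrt_mul hapos.le]
        refine Real.le_sqrt_of_sq_le ?_
        rw [mul_one_div, le_div_iff₀ hc]
        linarith
  refine ⟨1 + |C₁| + |C₂|, by linarith [abs_nonneg C₁, abs_nonneg C₂], fun E x a b h => ?_⟩
  obtain ⟨C, hC, G, hG, hGC, hr⟩ := key E x a b h
  exact ⟨G, hG, fun z => (hGC z).mono hC, hr⟩

theorem HasExtensionAt.inv_smul_mem {E : Finset E2} {x : E2} {C : ℝ} {p : AffPoly} (hC : 0 < C)
    (h : HasExtensionAt E x (p.1 + p.2 x) p.2 C) : C⁻¹ • p ∈ sigmaSet x (E : Set E2) := by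
  obtain ⟨G, hG, hGC, hGx, hGb, hGE⟩ := h
  have hd : DifferentiableAt ℝ G x := hG.differentiable (by norm_num) x
  refine ⟨C⁻¹ • G, hG.const_smul C⁻¹, fun y hy => by simp [hGE y hy], fun z i hi => ?_, ?_⟩
  · rw [iteratedFDeriv_const_smul_apply (hG.of_le (by exact_mod_cast hi)).contDiffAt, norm_smul,
      norm_inv, Real.norm_eq_abs, abs_of_pos hC, inv_mul_le_iff₀ hC, mul_one]
    exact hGC z i hi
  · have e : fderiv ℝ (C⁻¹ • G) x = C⁻¹ • p.2 := by
      rw [fderiv_const_smul hd, hGb]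
    unfold jet1
    rw [e]
    refine Prod.ext ?_ rfl
    simp [hGx]
    ring

theorem hasExtensionAt_of_mem_sigmaSet {E : Finset E2} {x : E2} {p : AffPoly}
    (h : p ∈ sigmaSet x (E : Set E2)) : HasExtensionAt E x (p.1 + p.2 x) p.2 1 := by
  obtain ⟨G, hG, hGE, hG1, rfl⟩ := h
  exact ⟨G, hG, hG1, by simp [jet1], rfl, hGE⟩

/-- Finiteness principle for `σ`:
`C⁻¹·σ♯(x,16) ⊆ σ(x,E) ⊆ C·σ♯(x,16)`. -/
theorem statement10 :
    ∃ C : ℝ, 0 < C ∧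
      ∀ E : Set E2, E.Finite → ∀ x : E2,
        C⁻¹ • sigmaSharp E x 16 ⊆ sigmaSet x E ∧
        sigmaSet x E ⊆ C • sigmaSharp E x 16 := by
  obtain ⟨C, hC1, hC⟩ := exists_extension
  have hC0 : 0 < C := by linarith
  refine ⟨C, hC0, fun E hE x => ?_⟩
  lift E to Finset E2 using hE
  constructor
  · rintro _ ⟨p, hp, rfl⟩
    refine HasExtensionAt.inv_smul_mem hC0 (hC E x _ _ fun S hS hcard => ?_)
    refine hasExtensionAt_of_mem_sigmaSet (Set.mem_iInter₂.1 hp S ⟨by exact_mod_cast hS, ?_⟩)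
    rw [Set.ncard_coe_finset]
    omega
  · intro p hp
    refine (Set.mem_smul_set_iff_inv_smul_mem₀ hC0.ne' _ _).2 (Set.mem_iInter₂.2 fun S hS => ?_)
    lift S to Finset E2 using E.finite_toSet.subset hS.1
    obtain ⟨G, hG, hG1, hGx, hGb, hGE⟩ := hasExtensionAt_of_mem_sigmaSet hp
    exact HasExtensionAt.inv_smul_mem hC0 ⟨G, hG, fun z => (hG1 z).mono hC1, hGx, hGb,
      fun z hz => hGE z (by exact_mod_cast hS.1 hz)⟩
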